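/- Let λ > 1. There exists M₀ > 0 depending only on λ such that: for every convex body K ⊂ ℝ³ containing the origin in its closure that solves the logarithmic Minkowski problem with density f with 1/λ < f < λ, if E is a John ellipsoid of K (E centered at the center of mass, E ⊂ K ⊂ 3^{3/2}E) with principal radii r₁ ≤ r₂ ≤ r₃, then r₃/r₂ ≤ M₀. -/

import Mathlib

open MeasureTheory Metric Set Filter
open scoped RealInnerProductSpace ENNReal NNReal Real

noncomputable section

abbrev E3 := EuclideanSpace ℝ (Fin 3)

def unitSphere : Set E3 := Metric.sphere 0 1

def IsConvexBody (K : Set E3) : Prop :=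
  Convex ℝ K ∧ IsCompact K ∧ (interior K).Nonempty

def suppFn (K : Set E3) (x : E3) : ℝ := sSup ((fun y => ⟪x, y⟫) '' K)

def outerNormalAt (K : Set E3) (x ν : E3) : Prop :=
  ‖ν‖ = 1 ∧ ∀ z ∈ K, ⟪ν, z - x⟫ ≤ (0:ℝ)

def gaussPre (K : Set E3) (ω : Set E3) : Set E3 :=
  {x ∈ frontier K | ∃ ν ∈ ω, outerNormalAt K x ν}

def coneOver (G : Set E3) : Set E3 := {y | ∃ x ∈ G, ∃ t ∈ Set.Icc (0:ℝ) 1, y = t • x}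

def SolvesLMP (K : Set E3) (f : E3 → ℝ) : Prop :=
  ∀ ω : Set E3, ω ⊆ unitSphere → MeasurableSet ω →
    3 * (volume (coneOver (gaussPre K ω))).toReal = ∫ u in ω, f u ∂(μH[2])

def sphSupNorm (f : E3 → ℝ) : ℝ := sSup {c | ∃ x ∈ unitSphere, c = |f x|}

def sphHolderSemi (α : ℝ) (f : E3 → ℝ) : ℝ :=
  sSup {c | ∃ x ∈ unitSphere, ∃ y ∈ unitSphere, x ≠ y ∧ c = |f x - f y| / ‖x - y‖ ^ α}

def sphHolderNorm (α : ℝ) (f : E3 → ℝ) : ℝ := sphSupNorm f + sphHolderSemi α f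

def IsEllipsoid (E : Set E3) (c : E3) (e : Fin 3 → E3) (r : Fin 3 → ℝ) : Prop :=
  (∀ i, 0 < r i) ∧ Orthonormal ℝ e ∧
  E = {x : E3 | (∑ i, (⟪x - c, e i⟫ / r i) ^ 2) ≤ 1}

def dilate (c : E3) (s : ℝ) (A : Set E3) : Set E3 := (fun x => c + s • (x - c)) '' A

def centerOfMass (K : Set E3) : E3 := ((volume K).toReal)⁻¹ • ∫ x in K, x

/-- `E ⊆ K ⊆ 3^{3/2} E`, the dilation taken about the center `c` of `E`. -/
def IsJohnEllipsoid (K E : Set E3) (c : E3) : Prop :=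
  E ⊆ K ∧ K ⊆ dilate c ((3:ℝ) ^ ((3:ℝ) / 2)) E


/-- normalised coordinates -/
def nc (c : E3) (e : Fin 3 → E3) (r : Fin 3 → ℝ) (x : E3) (i : Fin 3) : ℝ := ⟪x - c, e i⟫ / r i

def onb (e : Fin 3 → E3) (he : Orthonormal ℝ e) : OrthonormalBasis (Fin 3) ℝ E3 :=
  OrthonormalBasis.mk he (by
    have : LinearIndependent ℝ e := he.linearIndependent
    rw [this.span_eq_top_of_card_eq_finrank' (by simp)])

theorem onb_apply (e : Fin 3 → E3) (he : Orthonormal ℝ e) (i : Fin 3) : onb e he i = e i := by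
  simp [onb]

theorem vol_box (c : E3) (e : Fin 3 → E3) (he : Orthonormal ℝ e) (r : Fin 3 → ℝ)
    (hr : ∀ i, 0 < r i) (l u : Fin 3 → ℝ) (hlu : ∀ i, l i ≤ u i) :
    volume {x : E3 | ∀ i, nc c e r x i ∈ Icc (l i) (u i)}
      = ENNReal.ofReal (r 0 * r 1 * r 2 * ((u 0 - l 0) * (u 1 - l 1) * (u 2 - l 2))) := by
  have h1 := (EuclideanSpace.volume_preserving_symm_measurableEquiv_toLp (Fin 3)).comp
    (onb e he).measurePreserving_repr
  have h2 : {x : E3 | ∀ i, nc c e r x i ∈ Icc (l i) (u i)} =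
      ((MeasurableEquiv.toLp 2 (Fin 3 → ℝ)).symm ∘ (onb e he).repr) ⁻¹'
        (Set.pi univ fun i => Icc (r i * l i + ⟪c, e i⟫) (r i * u i + ⟪c, e i⟫)) := by
    ext x
    simp only [mem_ofPred_eq, mem_preimage, Set.mem_pi, mem_univ, forall_true_left]
    refine forall_congr' fun i => ?_
    have : ((MeasurableEquiv.toLp 2 (Fin 3 → ℝ)).symm ∘ (onb e he).repr) x i = ⟪x, e i⟫ := by
      change (onb e he).repr x i = _
      rw [OrthonormalBasis.repr_apply_apply, onb_apply, real_inner_comm]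
    rw [this, nc, inner_sub_left, mem_Icc, mem_Icc, le_div_iff₀ (hr i), div_le_iff₀ (hr i)]
    constructor <;> rintro ⟨h, h'⟩ <;> constructor <;> linarith
  have h3 : MeasurableSet
      (Set.pi univ fun i => Icc (r i * l i + ⟪c, e i⟫) (r i * u i + ⟪c, e i⟫)) :=
    MeasurableSet.univ_pi fun i => measurableSet_Icc
  have hD : 0 ≤ r 0 * r 1 * r 2 := by have := hr 0; have := hr 1; have := hr 2; positivity
  have hw : ∀ i, 0 ≤ r i * (u i - l i) := fun i => mul_nonneg (hr i).le (by linarith [hlu i])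
  rw [h2, h1.measure_preimage h3.nullMeasurableSet, volume_pi_pi, Fin.prod_univ_three]
  simp only [Real.volume_Icc]
  have hs : ∀ i, r i * u i + ⟪c, e i⟫ - (r i * l i + ⟪c, e i⟫) = r i * (u i - l i) := by
    intro i; ring
  simp only [hs]
  rw [← ENNReal.ofReal_mul (hw 0), ← ENNReal.ofReal_mul (mul_nonneg (hw 0) (hw 1))]
  congr 1; ring

theorem nc_lin (c : E3) (e : Fin 3 → E3) (r : Fin 3 → ℝ) (x y : E3) (t : ℝ) (i : Fin 3) :
    nc c e r ((1 - t) • x + t • y) i = (1 - t) * nc c e r x i + t * nc c e r y i := by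
  have : (1 - t) • x + t • y - c = (1 - t) • (x - c) + t • (y - c) := by module
  simp only [nc]
  rw [this, inner_add_left, real_inner_smul_left, real_inner_smul_left]
  ring

theorem nc_smul (c : E3) (e : Fin 3 → E3) (r : Fin 3 → ℝ) (y : E3) (t : ℝ) (i : Fin 3) :
    nc c e r (t • y) i = (1 - t) * nc c e r 0 i + t * nc c e r y i := by
  have := nc_lin c e r 0 y t i
  simpa using this

theorem inner_expand (e : Fin 3 → E3) (he : Orthonormal ℝ e) (x y : E3) :
    ⟪x, y⟫ = ⟪x, e 0⟫ * ⟪y, e 0⟫ + ⟪x, e 1⟫ * ⟪y, e 1⟫ + ⟪x, e 2⟫ * ⟪y, e 2⟫ := by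
  have := (onb e he).sum_inner_mul_inner x y
  rw [← this, Fin.sum_univ_three]
  simp only [onb_apply, real_inner_comm]

/-- points where the normal is inclined towards `e 2` lie near the top -/
theorem cap (K : Set E3) (c : E3) (e : Fin 3 → E3) (he : Orthonormal ℝ e) (r : Fin 3 → ℝ)
    (hr : ∀ i, 0 < r i) (h01 : r 0 ≤ r 1) (hK : ∀ x ∈ K, ∀ i, |nc c e r x i| ≤ 6)
    (δ : ℝ) (hδ : 0 < δ) (x u z : E3) (hx : x ∈ K) (hz : z ∈ K) (hu : outerNormalAt K x u)
    (hud : δ ≤ ⟪u, e 2⟫) :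
    nc c e r z 2 ≤ nc c e r x 2 + 24 * r 1 / (r 2 * δ) := by
  obtain ⟨hn, h⟩ := hu
  have hh := h z hz
  rw [inner_expand e he] at hh
  have key : ∀ i, ⟪z - x, e i⟫ = r i * (nc c e r z i - nc c e r x i) := by
    intro i
    have hi := (hr i).ne'
    have : z - x = (z - c) - (x - c) := by abel
    rw [this, inner_sub_left]; simp only [nc]; field_simp
  have hb : ∀ i, |⟪u, e i⟫| ≤ 1 := by
    intro i
    have := abs_real_inner_le_norm u (e i)
    rw [hn, he.1 i] at this; simpa using this
  have hd : ∀ i, -(12 * r i) ≤ ⟪u, e i⟫ * ⟪z - x, e i⟫ := by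
    intro i
    rw [key]
    have h1 : |⟪u, e i⟫ * (r i * (nc c e r z i - nc c e r x i))| ≤ 1 * (r i * 12) := by
      rw [abs_mul, abs_mul, abs_of_pos (hr i)]
      have : |nc c e r z i - nc c e r x i| ≤ 12 := by
        have := abs_sub (nc c e r z i) (nc c e r x i)
        linarith [hK x hx i, hK z hz i]
      have := hr i
      gcongr
      exact hb i
    linarith [neg_abs_le (⟪u, e i⟫ * (r i * (nc c e r z i - nc c e r x i)))]
  have h0 := hd 0
  have h1 := hd 1
  rw [key 2] at hh
  set d := nc c e r z 2 - nc c e r x 2 with hdd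
  have h2 := hr 2
  have h1p := hr 1
  suffices d ≤ 24 * r 1 / (r 2 * δ) by linarith
  rw [le_div_iff₀ (by positivity)]
  by_cases hd0 : d ≤ 0
  · have : d * (r 2 * δ) ≤ 0 := mul_nonpos_of_nonpos_of_nonneg hd0 (by positivity)
    linarith
  · push Not at hd0
    have : δ * (r 2 * d) ≤ ⟪u, e 2⟫ * (r 2 * d) := by gcongr
    nlinarith

/-- every nonzero point of K lies in the cone over a boundary point with a unit normal -/
theorem exists_exit (K : Set E3) (hK : IsConvexBody K) (y : E3) (hy : y ∈ K)
    (hy0 : y ≠ 0) : ∃ x ∈ frontier K, ∃ t ∈ Icc (0:ℝ) 1, y = t • x ∧ ∃ u, outerNormalAt K x u := by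
  obtain ⟨hc, hcomp, hint⟩ := hK
  have hfr : ∃ x ∈ frontier K, ∃ t ∈ Icc (0:ℝ) 1, y = t • x := by
    set S : Set ℝ := {s | 1 ≤ s ∧ s • y ∈ K} with hS
    have hn : 0 < ‖y‖ := norm_pos_iff.mpr hy0
    obtain ⟨C, hC⟩ := hcomp.isBounded.exists_norm_le
    have hSb : BddAbove S := by
      refine ⟨C / ‖y‖, ?_⟩
      rintro s ⟨hs1, hs⟩
      have := hC _ hs
      rw [norm_smul, Real.norm_of_nonneg (by linarith)] at this
      rwa [le_div_iff₀ hn]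
    have hSc : IsClosed S := by
      apply IsClosed.inter (isClosed_Ici (a := (1:ℝ)))
      exact hcomp.isClosed.preimage (by fun_prop)
    have hSn : S.Nonempty := ⟨1, le_rfl, by simpa using hy⟩
    have hm := hSc.csSup_mem hSn hSb
    set m := sSup S
    refine ⟨m • y, ⟨subset_closure hm.2, ?_⟩, m⁻¹, ⟨by have := hm.1; positivity,
      inv_le_one_of_one_le₀ hm.1⟩, ?_⟩
    · intro hi
      have hcont : ContinuousAt (fun s : ℝ => s • y) m := by fun_prop
      have := hcont.preimage_mem_nhds (mem_interior_iff_mem_nhds.mp hi)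
      obtain ⟨ε, hε, hb⟩ := Metric.mem_nhds_iff.mp this
      have h1 : m + ε / 2 ∈ Metric.ball m ε := by
        rw [Metric.mem_ball, Real.dist_eq]; simp [abs_of_pos (half_pos hε)]; linarith
      have h2 : m + ε / 2 ∈ S := ⟨by linarith [hm.1], hb h1⟩
      have := le_csSup hSb h2
      change m + ε / 2 ≤ m at this
      linarith
    · rw [smul_smul, inv_mul_cancel₀ (by linarith [hm.1]), one_smul]
  obtain ⟨x, hx, t, ht, hyt⟩ := hfr
  refine ⟨x, hx, t, ht, hyt, ?_⟩
  obtain ⟨g, hg⟩ := geometric_hahn_banach_open_point hc.interior isOpen_interior hx.2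
  have hgne : g ≠ 0 := by
    rintro rfl
    obtain ⟨a, ha⟩ := hint
    simpa using hg a ha
  have hg' : ∀ z ∈ K, g z ≤ g x := by
    intro z hz
    have : z ∈ closure (interior K) := by
      rw [hc.closure_interior_eq_closure_of_nonempty_interior hint]; exact subset_closure hz
    exact le_on_closure (fun a ha => (hg a ha).le) g.continuous.continuousOn
      continuousOn_const this
  set w := (InnerProductSpace.toDual ℝ E3).symm g with hw
  have hwne : w ≠ 0 := by simpa [hw] using hgne
  have hwn : 0 < ‖w‖ := norm_pos_iff.mpr hwne
  refine ⟨‖w‖⁻¹ • w, ?_, ?_⟩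
  · rw [norm_smul, norm_inv, norm_norm, inv_mul_cancel₀ hwn.ne']
  · intro z hz
    rw [real_inner_smul_left]
    have : ⟪w, z - x⟫ = g (z - x) := by rw [hw, InnerProductSpace.toDual_symm_apply]
    rw [this, map_sub]
    have := hg' z hz
    exact mul_nonpos_of_nonneg_of_nonpos (by positivity) (by linarith)

theorem cone_subset (K : Set E3) (hK : IsConvexBody K) (h0 : 0 ∈ K) (ω : Set E3) :
    coneOver (gaussPre K ω) ⊆ K := by
  rintro y ⟨x, hx, t, ht, rfl⟩
  have hxK : x ∈ K := hK.2.1.isClosed.frontier_subset hx.1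
  exact hK.1.smul_mem_of_zero_mem h0 hxK ht

def band (e : Fin 3 → E3) (δ : ℝ) : Set E3 := {u | u ∈ unitSphere ∧ |⟪u, e 2⟫| ≤ δ}
def top (e : Fin 3 → E3) (δ : ℝ) : Set E3 := {u | u ∈ unitSphere ∧ δ ≤ ⟪u, e 2⟫}

theorem band_measure (e : Fin 3 → E3) (he : Orthonormal ℝ e) (δ : ℝ) (hδ : 0 ≤ δ) (hδ1 : δ ≤ 1) :
    μH[2] (band e δ) ≤ ENNReal.ofReal (1152 * δ) := by
  let P : (Fin 2 → ℝ) → E3 := fun p =>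
    (Real.cos (p 0) * Real.cos (p 1)) • e 0 + (Real.cos (p 0) * Real.sin (p 1)) • e 1
      + Real.sin (p 0) • e 2
  have hP : LipschitzWith 6 P := by
    apply LipschitzWith.of_dist_le_mul
    intro p q
    have h0 : |p 0 - q 0| ≤ dist p q := by
      have := dist_le_pi_dist p q 0; rwa [Real.dist_eq] at this
    have h1 : |p 1 - q 1| ≤ dist p q := by
      have := dist_le_pi_dist p q 1; rwa [Real.dist_eq] at this
    have c0 := Real.abs_cos_sub_cos_le (p 0) (q 0)
    have c1 := Real.abs_cos_sub_cos_le (p 1) (q 1)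
    have s0 := Real.abs_sin_sub_sin_le (p 0) (q 0)
    have s1 := Real.abs_sin_sub_sin_le (p 1) (q 1)
    have cb0 := Real.abs_cos_le_one (p 0)
    have cb1 := Real.abs_cos_le_one (q 1)
    have sb1 := Real.abs_sin_le_one (q 1)
    have hd : 0 ≤ dist p q := dist_nonneg
    have A : |Real.cos (p 0) * Real.cos (p 1) - Real.cos (q 0) * Real.cos (q 1)| ≤
        2 * dist p q := by
      have : Real.cos (p 0) * Real.cos (p 1) - Real.cos (q 0) * Real.cos (q 1) =
        Real.cos (p 0) * (Real.cos (p 1) - Real.cos (q 1)) +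
          (Real.cos (p 0) - Real.cos (q 0)) * Real.cos (q 1) := by ring
      rw [this]
      refine (abs_add_le _ _).trans ?_
      rw [abs_mul, abs_mul]
      have i1 : |Real.cos (p 0)| * |Real.cos (p 1) - Real.cos (q 1)| ≤ 1 * dist p q := by
        gcongr; linarith
      have i2 : |Real.cos (p 0) - Real.cos (q 0)| * |Real.cos (q 1)| ≤ dist p q * 1 := by
        gcongr; linarith
      linarith
    have B : |Real.cos (p 0) * Real.sin (p 1) - Real.cos (q 0) * Real.sin (q 1)| ≤
        2 * dist p q := by
      have : Real.cos (p 0) * Real.sin (p 1) - Real.cos (q 0) * Real.sin (q 1) =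
        Real.cos (p 0) * (Real.sin (p 1) - Real.sin (q 1)) +
          (Real.cos (p 0) - Real.cos (q 0)) * Real.sin (q 1) := by ring
      rw [this]
      refine (abs_add_le _ _).trans ?_
      rw [abs_mul, abs_mul]
      have i1 : |Real.cos (p 0)| * |Real.sin (p 1) - Real.sin (q 1)| ≤ 1 * dist p q := by
        gcongr; linarith
      have i2 : |Real.cos (p 0) - Real.cos (q 0)| * |Real.sin (q 1)| ≤ dist p q * 1 := by
        gcongr; linarith
      linarith
    have hPP : P p - P q =
        (Real.cos (p 0) * Real.cos (p 1) - Real.cos (q 0) * Real.cos (q 1)) • e 0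
        + (Real.cos (p 0) * Real.sin (p 1) - Real.cos (q 0) * Real.sin (q 1)) • e 1
        + (Real.sin (p 0) - Real.sin (q 0)) • e 2 := by
      simp only [P]; module
    rw [dist_eq_norm, hPP]
    refine (norm_add₃_le).trans ?_
    rw [norm_smul, norm_smul, norm_smul, he.1, he.1, he.1, Real.norm_eq_abs, Real.norm_eq_abs,
      Real.norm_eq_abs]
    push_cast
    linarith
  set Bx : Set (Fin 2 → ℝ) := Set.pi univ fun i => Icc (![-(2 * δ), -4] i) (![2 * δ, 4] i) with hBx
  have hsub : band e δ ⊆ P '' Bx := by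
    rintro u ⟨hu, hud⟩
    have hn : ‖u‖ = 1 := by simpa [unitSphere] using hu
    have hsq : ⟪u, e 0⟫ * ⟪u, e 0⟫ + ⟪u, e 1⟫ * ⟪u, e 1⟫ + ⟪u, e 2⟫ * ⟪u, e 2⟫ = 1 := by
      rw [← inner_expand e he, real_inner_self_eq_norm_sq, hn]; norm_num
    set s := ⟪u, e 2⟫ with hs
    set a := ⟪u, e 0⟫
    set b := ⟪u, e 1⟫
    have hs1 := abs_le.mp (hud.trans hδ1)
    have hsin := Real.sin_arcsin hs1.1 hs1.2
    have hcos : Real.cos (Real.arcsin s) = ‖(⟨a, b⟩ : ℂ)‖ := by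
      rw [Real.cos_arcsin, Complex.norm_def, Complex.normSq_apply]
      congr 1; simp only; nlinarith
    have harc : |Real.arcsin s| ≤ 2 * δ := by
      have hpi := Real.pi_le_four
      have hh := Real.mul_abs_le_abs_sin (x := Real.arcsin s)
        (abs_le.mpr ⟨Real.neg_pi_div_two_le_arcsin s, Real.arcsin_le_pi_div_two s⟩)
      rw [hsin, div_mul_eq_mul_div, div_le_iff₀ Real.pi_pos] at hh
      nlinarith [Real.pi_pos, abs_nonneg s]
    refine ⟨![Real.arcsin s, Complex.arg ⟨a, b⟩], ?_, ?_⟩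
    · intro i _
      have hpi := Real.pi_le_four
      fin_cases i
      · simpa using abs_le.mp harc
      · have h1 := Complex.neg_pi_lt_arg ⟨a, b⟩
        have h2 := Complex.arg_le_pi ⟨a, b⟩
        simp only [Fin.mk_one, Matrix.cons_val_one, Matrix.cons_val_fin_one, mem_Icc]
        constructor <;> linarith
    · simp only [P, Matrix.cons_val_zero, Matrix.cons_val_one, Matrix.cons_val_fin_one]
      rw [hsin, hcos, Complex.norm_mul_cos_arg, Complex.norm_mul_sin_arg]
      have := (onb e he).sum_repr' u
      rw [Fin.sum_univ_three] at this
      simp only [onb_apply] at this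
      conv_rhs => rw [← this]
      simp only [real_inner_comm]
      rfl
  have hvol : μH[2] Bx = ENNReal.ofReal (32 * δ) := by
    have : (μH[2] : Measure (Fin 2 → ℝ)) = volume := by
      have := hausdorffMeasure_pi_real (ι := Fin 2)
      simpa using this
    rw [this, hBx, volume_pi_pi, Fin.prod_univ_two]
    simp only [Real.volume_Icc, Matrix.cons_val_zero, Matrix.cons_val_one, Matrix.cons_val_fin_one]
    rw [← ENNReal.ofReal_mul (by linarith)]
    congr 1; ring
  calc μH[2] (band e δ) ≤ μH[2] (P '' Bx) := measure_mono hsub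
    _ ≤ ((6 : ℝ≥0) : ℝ≥0∞) ^ (2:ℝ) * μH[2] Bx := hP.hausdorffMeasure_image_le (by norm_num) Bx
    _ = ENNReal.ofReal (1152 * δ) := by
      rw [hvol]
      have : ((6 : ℝ≥0) : ℝ≥0∞) ^ (2:ℝ) = ENNReal.ofReal 36 := by
        rw [← ENNReal.ofReal_coe_nnreal, ENNReal.ofReal_rpow_of_pos (by norm_num)]
        norm_num
      rw [this, ← ENNReal.ofReal_mul (by norm_num)]
      congr 1; ring

theorem top_measure (e : Fin 3 → E3) (he : Orthonormal ℝ e) (δ : ℝ) (hδ1 : δ ≤ 1/2) :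
    1 ≤ μH[2] (top e δ) := by
  let P : E3 → (Fin 2 → ℝ) := fun x => ![⟪x, e 0⟫, ⟪x, e 1⟫]
  have hP : LipschitzWith 1 P := by
    apply LipschitzWith.of_dist_le_mul
    intro x y
    have hb : ∀ i, dist (⟪x, e i⟫ : ℝ) ⟪y, e i⟫ ≤ dist x y := by
      intro i
      rw [Real.dist_eq, ← inner_sub_left, dist_eq_norm]
      have := abs_real_inner_le_norm (x - y) (e i)
      rw [he.1 i] at this; simpa using this
    rw [NNReal.coe_one, one_mul, dist_pi_le_iff dist_nonneg]
    intro i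
    fin_cases i
    · exact hb 0
    · exact hb 1
  set Bx : Set (Fin 2 → ℝ) := Set.pi univ fun _ => Icc (-(1/2)) (1/2) with hBx
  have hsub : Bx ⊆ P '' top e δ := by
    intro p hp
    have h0 := hp 0 (mem_univ _)
    have h1 := hp 1 (mem_univ _)
    simp only [mem_Icc] at h0 h1
    have hsq : 1/4 ≤ 1 - p 0 ^ 2 - p 1 ^ 2 := by nlinarith
    set w := Real.sqrt (1 - p 0 ^ 2 - p 1 ^ 2) with hw
    have hw2 : w ^ 2 = 1 - p 0 ^ 2 - p 1 ^ 2 := Real.sq_sqrt (by linarith)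
    have hwge : 1/2 ≤ w := Real.le_sqrt_of_sq_le (by linarith)
    set u : E3 := p 0 • e 0 + p 1 • e 1 + w • e 2 with hu
    have hoo : ∀ i j, ⟪e i, e j⟫ = if i = j then (1:ℝ) else 0 := orthonormal_iff_ite.mp he
    have u0 : ⟪u, e 0⟫ = p 0 := by
      simp [hu, inner_add_left, real_inner_smul_left, hoo, he.1]
    have u1 : ⟪u, e 1⟫ = p 1 := by
      simp [hu, inner_add_left, real_inner_smul_left, hoo, he.1]
    have u2 : ⟪u, e 2⟫ = w := by
      simp [hu, inner_add_left, real_inner_smul_left, hoo, he.1]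
    refine ⟨u, ⟨?_, ?_⟩, ?_⟩
    · have : ‖u‖ ^ 2 = 1 := by
        rw [← real_inner_self_eq_norm_sq, inner_expand e he, u0, u1, u2]; nlinarith
      have : ‖u‖ = 1 := by
        exact (pow_eq_one_iff_of_nonneg (norm_nonneg _) two_ne_zero).mp this
      simpa [unitSphere] using this
    · rw [u2]; linarith
    · simp only [P, u0, u1]
      ext i; fin_cases i <;> rfl
  have hvol : μH[2] Bx = 1 := by
    have : (μH[2] : Measure (Fin 2 → ℝ)) = volume := by
      have := hausdorffMeasure_pi_real (ι := Fin 2)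
      simpa using this
    rw [this, hBx, volume_pi_pi, Fin.prod_univ_two]
    simp only [Real.volume_Icc]
    norm_num
  calc 1 = μH[2] Bx := hvol.symm
    _ ≤ μH[2] (P '' top e δ) := measure_mono hsub
    _ ≤ ((1 : ℝ≥0) : ℝ≥0∞) ^ (2:ℝ) * μH[2] (top e δ) :=
      hP.hausdorffMeasure_image_le (by norm_num) _
    _ = μH[2] (top e δ) := by simp

theorem meas_sphere : MeasurableSet unitSphere := Metric.isClosed_sphere.measurableSet

theorem meas_band (e : Fin 3 → E3) (δ : ℝ) : MeasurableSet (band e δ) := by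
  have h : IsClosed {u : E3 | |⟪u, e 2⟫| ≤ δ} := isClosed_le (by fun_prop) continuous_const
  exact meas_sphere.inter h.measurableSet

theorem meas_top (e : Fin 3 → E3) (δ : ℝ) : MeasurableSet (top e δ) := by
  have h : IsClosed {u : E3 | δ ≤ ⟪u, e 2⟫} := isClosed_le continuous_const (by fun_prop)
  exact meas_sphere.inter h.measurableSet

theorem sphere_eq_band (e : Fin 3 → E3) (he : Orthonormal ℝ e) : unitSphere = band e 1 := by
  ext u
  constructor
  · intro hu
    refine ⟨hu, ?_⟩
    have hn : ‖u‖ = 1 := by simpa [unitSphere] using hu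
    have := abs_real_inner_le_norm u (e 2)
    rw [hn, he.1] at this; simpa using this
  · exact fun h => h.1

theorem cone_full (K : Set E3) (hK : IsConvexBody K) (h0 : 0 ∈ K) :
    volume (coneOver (gaussPre K unitSphere)) = volume K := by
  apply le_antisymm (measure_mono (cone_subset K hK h0 _))
  calc volume K ≤ volume (coneOver (gaussPre K unitSphere) ∪ {0}) := by
        apply measure_mono
        intro y hy
        by_cases hy0 : y = 0
        · right; exact hy0
        · left
          obtain ⟨x, hx, t, ht, hyt, u, hu⟩ := exists_exit K hK y hy hy0
          exact ⟨x, ⟨hx, u, by simpa [unitSphere] using hu.1, hu⟩, t, ht, hyt⟩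
    _ ≤ volume (coneOver (gaussPre K unitSphere)) + volume ({0} : Set E3) := measure_union_le _ _
    _ = _ := by simp

theorem lmp_bounds (lam : ℝ) (hlam : 1 < lam) (f : E3 → ℝ) (K : Set E3)
    (hf : ∀ u ∈ unitSphere, 1 / lam < f u ∧ f u < lam) (hK : IsConvexBody K) (h0 : 0 ∈ K)
    (hL : SolvesLMP K f) (hfin : μH[2] unitSphere ≠ ∞) (ω : Set E3) (hω : ω ⊆ unitSphere)
    (hm : MeasurableSet ω) :
    1 / lam * (μH[2] ω).toReal ≤ 3 * (volume (coneOver (gaussPre K ω))).toReal ∧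
    3 * (volume (coneOver (gaussPre K ω))).toReal ≤ lam * (μH[2] ω).toReal := by
  have hS := hL unitSphere subset_rfl meas_sphere
  rw [cone_full K hK h0] at hS
  have hpos : 0 < (volume K).toReal := by
    apply ENNReal.toReal_pos
    · exact (Measure.measure_pos_of_nonempty_interior volume hK.2.2).ne'
    · exact hK.2.1.measure_lt_top.ne
  have hint : IntegrableOn f unitSphere μH[2] := by
    by_contra h
    rw [integral_undef h] at hS
    linarith
  have hintω : IntegrableOn f ω μH[2] := hint.mono_set hω
  have hfinω : μH[2] ω ≠ ∞ := ne_top_of_le_ne_top hfin (measure_mono hω)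
  rw [hL ω hω hm]
  have hc : ∀ a : ℝ, IntegrableOn (fun _ => a) ω (μH[2] : Measure E3) :=
    fun a => integrableOn_const hfinω
  have hci : ∀ a : ℝ, ∫ _ in ω, a ∂(μH[2] : Measure E3) = a * (μH[2] ω).toReal := by
    intro a
    rw [setIntegral_const, smul_eq_mul, mul_comm]; rfl
  constructor
  · rw [← hci]
    exact setIntegral_mono_on (hc _) hintω hm fun u hu => (hf u (hω hu)).1.le
  · rw [← hci]
    exact setIntegral_mono_on hintω (hc _) hm fun u hu => (hf u (hω hu)).2.le

theorem vol_le_box (c : E3) (e : Fin 3 → E3) (he : Orthonormal ℝ e) (r : Fin 3 → ℝ)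
    (hr : ∀ i, 0 < r i) (l u : Fin 3 → ℝ) (hlu : ∀ i, l i ≤ u i) (A : Set E3)
    (hA : ∀ x ∈ A, ∀ i, nc c e r x i ∈ Icc (l i) (u i)) :
    (volume A).toReal ≤ r 0 * r 1 * r 2 * ((u 0 - l 0) * (u 1 - l 1) * (u 2 - l 2)) := by
  have h : volume A ≤ _ := (measure_mono hA).trans_eq (vol_box c e he r hr l u hlu)
  apply ENNReal.toReal_le_of_le_ofReal _ h
  have := hr 0; have := hr 1; have := hr 2
  have := sub_nonneg.mpr (hlu 0); have := sub_nonneg.mpr (hlu 1); have := sub_nonneg.mpr (hlu 2)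
  positivity

/-- the ratio-free part: `D`, the top and the bottom -/
theorem exists_high (lam : ℝ) (hlam : 1 < lam) (f : E3 → ℝ) (K : Set E3)
    (hf : ∀ u ∈ unitSphere, 1 / lam < f u ∧ f u < lam) (hK : IsConvexBody K) (h0 : 0 ∈ K)
    (hL : SolvesLMP K f)
    (c : E3) (e : Fin 3 → E3) (he : Orthonormal ℝ e) (r : Fin 3 → ℝ)
    (hr : ∀ i, 0 < r i) (h01 : r 0 ≤ r 1) (hKb : ∀ x ∈ K, ∀ i, |nc c e r x i| ≤ 6)
    (hD : 3 * (r 0 * r 1 * r 2) ≤ lam * 1152)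
    (δ k : ℝ) (hδ : 0 < δ) (hδ2 : δ ≤ 1 / 2) (hk : k = 1 / (10 ^ 6 * lam ^ 2))
    (hη : 24 * r 1 / (r 2 * δ) ≤ k / 2) :
    ∃ p ∈ K, nc c e r 0 2 + k ≤ nc c e r p 2 := by
  by_contra! hcon
  have hkpos : 0 < k := by rw [hk]; positivity
  set o := nc c e r 0 2 with ho
  have hSfin : μH[2] unitSphere ≠ ∞ := by
    rw [sphere_eq_band e he]
    exact ne_top_of_le_ne_top ENNReal.ofReal_ne_top
      (band_measure e he 1 zero_le_one le_rfl)
  have htsub : top e δ ⊆ unitSphere := fun u hu => hu.1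
  have hb := (lmp_bounds lam hlam f K hf hK h0 hL hSfin (top e δ) htsub (meas_top e δ)).1
  have ht : 1 ≤ (μH[2] (top e δ)).toReal := by
    have := ENNReal.toReal_mono (ne_top_of_le_ne_top hSfin (measure_mono htsub))
      (top_measure e he δ hδ2)
    simpa using this
  have hbox := vol_le_box c e he r hr ![-6, -6, o - k / 2] ![6, 6, o + k]
    (by intro i; fin_cases i <;> simp; linarith)
    (coneOver (gaussPre K (top e δ))) (by
      intro y hy
      have hyK := cone_subset K hK h0 _ hy
      obtain ⟨x, ⟨hxf, u, hu, hun⟩, t, ht, rfl⟩ := hy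
      have hxK : x ∈ K := hK.2.1.isClosed.frontier_subset hxf
      have hc := cap K c e he r hr h01 hKb δ hδ x u 0 hxK h0 hun hu.2
      have h2 := nc_smul c e r x t 2
      have h3 := hcon _ hyK
      intro i
      fin_cases i
      · simpa using abs_le.mp (hKb _ hyK 0)
      · simpa using abs_le.mp (hKb _ hyK 1)
      · change nc c e r (t • x) 2 ∈ Icc (o - k / 2) (o + k)
        refine ⟨?_, h3.le⟩
        rw [h2]
        rw [← ho] at hc ⊢
        nlinarith [ht.1, ht.2])
  simp only [Matrix.cons_val_zero, Matrix.cons_val_one, Matrix.cons_val] at hbox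
  set D := r 0 * r 1 * r 2
  have e1 : 1 / lam ≤ 1 / lam * (μH[2] (top e δ)).toReal :=
    le_mul_of_one_le_right (by positivity) ht
  have e2 : 1 / lam ≤ 3 * D * (216 * k) := by nlinarith
  have e3 : 3 * D * (216 * k) ≤ lam * 1152 * (216 * k) := by gcongr
  have e4 : lam * 1152 * (216 * k) = (1 / lam) * (248832 / 10 ^ 6) := by
    rw [hk]; field_simp; norm_num
  have : 0 < 1 / lam := by positivity
  linarith

def flipB (e : Fin 3 → E3) : Fin 3 → E3 := ![e 0, e 1, - e 2]

theorem flip_on (e : Fin 3 → E3) (he : Orthonormal ℝ e) : Orthonormal ℝ (flipB e) := by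
  have hoo : ∀ i j, ⟪e i, e j⟫ = if i = j then (1:ℝ) else 0 := orthonormal_iff_ite.mp he
  rw [orthonormal_iff_ite]
  intro i j
  fin_cases i <;> fin_cases j <;> simp [flipB, hoo, he.1]

theorem nc_flip (c : E3) (e : Fin 3 → E3) (r : Fin 3 → ℝ) (x : E3) :
    nc c (flipB e) r x 0 = nc c e r x 0 ∧ nc c (flipB e) r x 1 = nc c e r x 1 ∧
    nc c (flipB e) r x 2 = - nc c e r x 2 := by
  refine ⟨rfl, rfl, ?_⟩
  simp [nc, flipB, neg_div]

theorem inner_box (K : Set E3) (hK : Convex ℝ K) (c : E3) (e : Fin 3 → E3) (r : Fin 3 → ℝ)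
    (hr : ∀ i, 0 < r i) (hB : ∀ x, ∑ i, (nc c e r x i) ^ 2 ≤ 1 → x ∈ K) (p : E3) (hp : p ∈ K)
    (t ρ : ℝ) (ht : 0 ≤ t) (hρ : 0 < ρ) (htρ : ρ ≤ 1 - t) (y : E3)
    (hy : ∀ i, |nc c e r y i - t * nc c e r p i| ≤ ρ / 2) : y ∈ K := by
  have h1t : 0 < 1 - t := by linarith
  set b : E3 := (1 - t)⁻¹ • (y - t • p) with hb
  have hyb : y = (1 - t) • b + t • p := by
    rw [hb, smul_smul, mul_inv_cancel₀ h1t.ne']; module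
  have hbK : b ∈ K := by
    apply hB
    have hi : ∀ i, nc c e r b i ^ 2 ≤ 1 / 4 := by
      intro i
      have h1 := nc_lin c e r b p t i
      rw [← hyb] at h1
      have h2 := hy i
      rw [h1, add_sub_cancel_right, abs_mul, abs_of_pos h1t] at h2
      have h3 : |nc c e r b i| ≤ 1 / 2 := by
        by_contra! h
        nlinarith
      have := abs_le.mp h3
      nlinarith
    rw [Fin.sum_univ_three]
    linarith [hi 0, hi 1, hi 2]
  rw [hyb]
  exact hK hbK hp h1t.le ht (by ring)

set_option maxHeartbeats 1600000 in
theorem core (lam : ℝ) (hlam : 1 < lam) (f : E3 → ℝ) (K : Set E3)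
    (hf : ∀ u ∈ unitSphere, 1 / lam < f u ∧ f u < lam) (hK : IsConvexBody K) (h0 : 0 ∈ K)
    (hL : SolvesLMP K f)
    (c : E3) (e : Fin 3 → E3) (he : Orthonormal ℝ e) (r : Fin 3 → ℝ)
    (hr : ∀ i, 0 < r i) (h01 : r 0 ≤ r 1) (hKb : ∀ x ∈ K, ∀ i, |nc c e r x i| ≤ 6)
    (hB : ∀ x, ∑ i, (nc c e r x i) ^ 2 ≤ 1 → x ∈ K)
    (δ k : ℝ) (hk : k = 1 / (10 ^ 6 * lam ^ 2)) (hδ : δ = k ^ 4 / (10 ^ 12 * lam ^ 2))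
    (hη : 24 * r 1 / (r 2 * δ) ≤ k / 2) : False := by
  have hkpos : 0 < k := by rw [hk]; positivity
  have hδpos : 0 < δ := by rw [hδ]; positivity
  have hk1 : k ≤ 1 := by
    rw [hk, div_le_one (by positivity)]; nlinarith
  have hδ2 : δ ≤ 1 / 2 := by
    rw [hδ, div_le_iff₀ (by positivity)]
    have : k ^ 4 ≤ 1 := pow_le_one₀ hkpos.le hk1
    nlinarith
  have hSb := band_measure e he 1 zero_le_one le_rfl
  rw [← sphere_eq_band e he] at hSb
  have hSfin : μH[2] unitSphere ≠ ∞ := ne_top_of_le_ne_top ENNReal.ofReal_ne_top hSb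
  have hSr : (μH[2] unitSphere).toReal ≤ 1152 :=
    ENNReal.toReal_le_of_le_ofReal (by norm_num) (by simpa using hSb)
  have hS1 : 1 ≤ (μH[2] unitSphere).toReal := by
    have := ENNReal.toReal_mono hSfin
      ((top_measure e he δ hδ2).trans (measure_mono (fun u hu => hu.1)))
    simpa using this
  have hVS := lmp_bounds lam hlam f K hf hK h0 hL hSfin unitSphere subset_rfl meas_sphere
  rw [cone_full K hK h0] at hVS
  have hKfin : volume K ≠ ∞ := hK.2.1.measure_lt_top.ne
  have hrpos : 0 < r 0 * r 1 * r 2 := by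
    have := hr 0; have := hr 1; have := hr 2; positivity
  -- volume of K against D
  have hDle : r 0 * r 1 * r 2 ≤ (volume K).toReal := by
    have h := vol_box c e he r hr (fun _ => -(1/2)) (fun _ => 1/2) (by intro i; norm_num)
    have h2 : {x : E3 | ∀ i, nc c e r x i ∈ Icc (-(1/2) : ℝ) (1/2)} ⊆ K := by
      intro x hx
      apply hB
      have hi : ∀ i, nc c e r x i ^ 2 ≤ 1 / 4 := by
        intro i
        have := hx i
        nlinarith [this.1, this.2]
      rw [Fin.sum_univ_three]
      linarith [hi 0, hi 1, hi 2]
    have h3 := ENNReal.toReal_mono hKfin (measure_mono h2)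
    rw [h, ENNReal.toReal_ofReal (by norm_num; linarith)] at h3
    norm_num at h3
    exact h3
  have hDge : (volume K).toReal ≤ r 0 * r 1 * r 2 * 1728 := by
    have := vol_le_box c e he r hr (fun _ => -6) (fun _ => 6) (by intro i; norm_num) K
      (fun x hx i => abs_le.mp (hKb x hx i))
    norm_num at this
    exact this
  have hD : 3 * (r 0 * r 1 * r 2) ≤ lam * 1152 := by
    have : lam * (μH[2] unitSphere).toReal ≤ lam * 1152 := by gcongr
    linarith [hVS.2]
  obtain ⟨p, hp, hpo⟩ := exists_high lam hlam f K hf hK h0 hL c e he r hr h01 hKb hD δ k hδpos hδ2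
    hk hη
  have hKb' : ∀ x ∈ K, ∀ i, |nc c (flipB e) r x i| ≤ 6 := by
    intro x hx i
    obtain ⟨f0, f1, f2⟩ := nc_flip c e r x
    fin_cases i
    · exact hKb x hx 0
    · exact hKb x hx 1
    · change |nc c (flipB e) r x 2| ≤ 6
      rw [f2, abs_neg]; exact hKb x hx 2
  obtain ⟨q, hq, hqo⟩ := exists_high lam hlam f K hf hK h0 hL c (flipB e) (flip_on e he) r hr h01
    hKb' hD δ k hδpos hδ2 hk hη
  rw [(nc_flip c e r _).2.2, (nc_flip c e r _).2.2] at hqo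
  set o := nc c e r 0 2 with ho
  -- a ball at the height of the origin
  obtain ⟨s, hs, t, ht, hts, hto⟩ : ∃ s ∈ K, ∃ t : ℝ, 0 ≤ t ∧ k / 6 ≤ 1 - t ∧
      t * nc c e r s 2 = o := by
    have hp6 := abs_le.mp (hKb p hp 2)
    have hq6 := abs_le.mp (hKb q hq 2)
    rcases le_or_gt 0 o with h | h
    · have hm : 0 < nc c e r p 2 := by linarith
      refine ⟨p, hp, o / nc c e r p 2, by positivity, ?_, by field_simp⟩
      rw [one_sub_div hm.ne', le_div_iff₀ hm]
      nlinarith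
    · have hm : nc c e r q 2 < 0 := by linarith
      refine ⟨q, hq, o / nc c e r q 2, div_nonneg_of_nonpos h.le hm.le, ?_, by
        rw [div_mul_cancel₀ _ hm.ne]⟩
      rw [one_sub_div hm.ne, le_div_iff_of_neg hm]
      nlinarith
  set κ := k ^ 2 / 576 with hκ
  have hκpos : 0 < κ := by positivity
  have hκk : κ ≤ k / 12 := by rw [hκ]; nlinarith
  set a0 := t * nc c e r s 0
  set a1 := t * nc c e r s 1
  set l : Fin 3 → ℝ := ![a0 - k / 12, a1 - k / 12, o + κ / 2] with hl
  set u : Fin 3 → ℝ := ![a0 + k / 12, a1 + k / 12, o + κ] with hu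
  have hlu : ∀ i, l i ≤ u i := by
    intro i; fin_cases i <;> simp [hl, hu] <;> linarith
  set Q := {x : E3 | ∀ i, nc c e r x i ∈ Icc (l i) (u i)} with hQ
  have hQvol := vol_box c e he r hr l u hlu
  rw [← hQ] at hQvol
  set D := r 0 * r 1 * r 2
  have hQvol' : volume Q = ENNReal.ofReal (D * ((k / 6) * (k / 6) * (κ / 2))) := by
    rw [hQvol]; simp only [hl, hu, Matrix.cons_val_zero, Matrix.cons_val_one, Matrix.cons_val]
    congr 1; ring
  set X := {x : E3 | ∀ i, nc c e r x i ∈ Icc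
    ((![nc c e r 0 0 - 24 * κ / k, nc c e r 0 1 - 24 * κ / k, o] : Fin 3 → ℝ) i)
    ((![nc c e r 0 0 + 24 * κ / k, nc c e r 0 1 + 24 * κ / k, o + κ] : Fin 3 → ℝ) i)} with hX
  have hXvol : volume X = ENNReal.ofReal (D * ((48 * κ / k) * (48 * κ / k) * κ)) := by
    rw [hX, vol_box c e he r hr _ _ (by
      have : 0 < 24 * κ / k := by positivity
      intro i; fin_cases i <;> simp <;> linarith)]
    simp only [Matrix.cons_val_zero, Matrix.cons_val_one, Matrix.cons_val]
    congr 1; ring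
  have hcover : Q ⊆ coneOver (gaussPre K (band e δ)) ∪ X := by
    intro y hy
    have y0 : nc c e r y 0 ∈ Icc (a0 - k / 12) (a0 + k / 12) := hy 0
    have y1 : nc c e r y 1 ∈ Icc (a1 - k / 12) (a1 + k / 12) := hy 1
    have y2 : nc c e r y 2 ∈ Icc (o + κ / 2) (o + κ) := hy 2
    have hyK : y ∈ K := by
      apply inner_box K hK.1 c e r hr hB s hs t (k / 6) ht (by positivity) hts
      intro i
      rw [abs_le]
      fin_cases i
      · constructor
        · have := y0.1; simp only [a0] at this; change _ ≤ nc c e r y 0 - t * nc c e r s 0; linarith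
        · have := y0.2; simp only [a0] at this; change nc c e r y 0 - t * nc c e r s 0 ≤ _; linarith
      · constructor
        · have := y1.1; simp only [a1] at this; change _ ≤ nc c e r y 1 - t * nc c e r s 1; linarith
        · have := y1.2; simp only [a1] at this; change nc c e r y 1 - t * nc c e r s 1 ≤ _; linarith
      · change -(k / 6 / 2) ≤ nc c e r y 2 - t * nc c e r s 2 ∧
          nc c e r y 2 - t * nc c e r s 2 ≤ k / 6 / 2
        rw [hto]
        constructor <;> linarith [y2.1, y2.2]
    have hyne : y ≠ 0 := by
      rintro rfl
      have := y2.1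
      rw [← ho] at this; linarith
    obtain ⟨x, hx, τ, hτ, hyt, w, hw⟩ := exists_exit K hK y hyK hyne
    have hws : w ∈ unitSphere := by simpa [unitSphere] using hw.1
    have hxK : x ∈ K := hK.2.1.isClosed.frontier_subset hx
    have hnc : ∀ i, nc c e r y i = (1 - τ) * nc c e r 0 i + τ * nc c e r x i := by
      intro i; rw [hyt, nc_smul]
    have hn2 := hnc 2
    rw [← ho] at hn2
    by_cases hwb : |⟪w, e 2⟫| ≤ δ
    · left
      exact ⟨x, ⟨hx, w, ⟨hws, hwb⟩, hw⟩, τ, hτ, hyt⟩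
    right
    rw [not_le, lt_abs] at hwb
    rcases hwb with hwt | hwt
    · have hcap := cap K c e he r hr h01 hKb δ hδpos x w p hxK hp hw hwt.le
      have hxo : k / 2 ≤ nc c e r x 2 - o := by linarith
      have hτk : τ * (k / 2) ≤ κ := by
        have : τ * (k / 2) ≤ τ * (nc c e r x 2 - o) := by
          have := hτ.1; gcongr
        nlinarith [y2.2]
      have hτ2 : 12 * τ ≤ 24 * κ / k := by
        rw [le_div_iff₀ hkpos]; linarith
      have hside : ∀ i, nc c e r y i ∈ Icc (nc c e r 0 i - 24 * κ / k)
          (nc c e r 0 i + 24 * κ / k) := by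
        intro i
        have b1 := abs_le.mp (hKb x hxK i)
        have b2 := abs_le.mp (hKb 0 h0 i)
        have hτ0 := hτ.1
        have d1 : τ * (nc c e r x i - nc c e r 0 i) ≤ τ * 12 :=
          mul_le_mul_of_nonneg_left (by linarith) hτ0
        have d2 : τ * (-12) ≤ τ * (nc c e r x i - nc c e r 0 i) :=
          mul_le_mul_of_nonneg_left (by linarith) hτ0
        have d3 : nc c e r y i = nc c e r 0 i + τ * (nc c e r x i - nc c e r 0 i) := by
          rw [hnc i]; ring
        rw [d3]
        constructor <;> linarith
      intro i
      fin_cases i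
      · exact hside 0
      · exact hside 1
      · exact ⟨by have := y2.1; change o ≤ nc c e r y 2; linarith, y2.2⟩
    · exfalso
      have hwt' : δ ≤ ⟪w, flipB e 2⟫ := by
        have : flipB e 2 = - e 2 := rfl
        rw [this, inner_neg_right]; exact hwt.le
      have hcap := cap K c (flipB e) (flip_on e he) r hr h01 hKb' δ hδpos x w q hxK hq hw hwt'
      rw [(nc_flip c e r _).2.2, (nc_flip c e r _).2.2] at hcap
      have hxo : nc c e r x 2 - o ≤ 0 := by linarith
      nlinarith [y2.1, hτ.1]
  have hmeas := (measure_mono hcover).trans (measure_union_le (μ := volume) _ _)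
  have hWfin : volume (coneOver (gaussPre K (band e δ))) ≠ ∞ :=
    ne_top_of_le_ne_top hKfin (measure_mono (cone_subset K hK h0 _))
  have hreal : D * ((k / 6) * (k / 6) * (κ / 2)) ≤
      (volume (coneOver (gaussPre K (band e δ)))).toReal +
        D * ((48 * κ / k) * (48 * κ / k) * κ) := by
    have := ENNReal.toReal_mono (by rw [hXvol]; simp [hWfin]) hmeas
    rw [ENNReal.toReal_add hWfin (by rw [hXvol]; simp), hXvol, hQvol',
      ENNReal.toReal_ofReal (by positivity), ENNReal.toReal_ofReal (by positivity)] at this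
    exact this
  have hVW := (lmp_bounds lam hlam f K hf hK h0 hL hSfin (band e δ) (fun u hu => hu.1)
    (meas_band e δ)).2
  have hWr : (μH[2] (band e δ)).toReal ≤ 1152 * δ :=
    ENNReal.toReal_le_of_le_ofReal (by positivity)
      (band_measure e he δ hδpos.le (by linarith))
  have hVW2 : lam * (μH[2] (band e δ)).toReal ≤ lam * (1152 * δ) := by gcongr
  have hX2 : D * ((48 * κ / k) * (48 * κ / k) * κ) = D * (k ^ 4 / 82944) := by
    rw [hκ]; field_simp; norm_num
  have hQ2 : D * ((k / 6) * (k / 6) * (κ / 2)) = D * (k ^ 4 / 82944) * 2 := by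
    rw [hκ]; ring
  have hfin1 : D * (k ^ 4 / 82944) ≤ 384 * lam * δ := by linarith
  have hDlow : 1 / lam ≤ 5184 * D := by
    have : 1 / lam ≤ 1 / lam * (μH[2] unitSphere).toReal :=
      le_mul_of_one_le_right (by positivity) hS1
    linarith [hVS.1]
  have hfin2 : 1 / lam * (k ^ 4 / 82944) ≤ 5184 * D * (k ^ 4 / 82944) := by gcongr
  have hfin3 : 384 * lam * δ = 1 / lam * k ^ 4 * (384 / 10 ^ 12) := by
    rw [hδ]; field_simp
  have : 0 < 1 / lam * k ^ 4 := by positivity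
  nlinarith

theorem stmt4 (lam : ℝ) (hlam : 1 < lam) :
    ∃ M₀ > 0, ∀ (f : E3 → ℝ) (K E : Set E3) (c : E3) (e : Fin 3 → E3) (r : Fin 3 → ℝ),
      (∀ u ∈ unitSphere, 1 / lam < f u ∧ f u < lam) →
      IsConvexBody K → 0 ∈ K → SolvesLMP K f →
      IsEllipsoid E c e r → c = centerOfMass K → IsJohnEllipsoid K E c →
      r 0 ≤ r 1 → r 1 ≤ r 2 →
      r 2 / r 1 ≤ M₀ := by
  set k : ℝ := 1 / (10 ^ 6 * lam ^ 2) with hk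
  set δ : ℝ := k ^ 4 / (10 ^ 12 * lam ^ 2) with hδ
  have hkpos : 0 < k := by positivity
  have hδpos : 0 < δ := by positivity
  refine ⟨48 / (δ * k), by positivity, ?_⟩
  intro f K E c e r hf hK h0 hL hE _ hJ h01 _
  obtain ⟨hr, he, rfl⟩ := hE
  obtain ⟨hJ1, hJ2⟩ := hJ
  by_contra! hcon
  have hr1 := hr 1
  have hr2 := hr 2
  refine core lam hlam f K hf hK h0 hL c e he r hr h01 ?_ (fun x hx => hJ1 hx) δ k hk hδ ?_
  · intro x hx i
    obtain ⟨y, hy, rfl⟩ := hJ2 hx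
    have hs0 : (0:ℝ) ≤ (3:ℝ) ^ ((3:ℝ) / 2) := by positivity
    have hs6 : (3:ℝ) ^ ((3:ℝ) / 2) ≤ 6 := by
      have h2 : ((3:ℝ) ^ ((3:ℝ) / 2)) ^ 2 = 27 := by
        rw [← Real.rpow_natCast, ← Real.rpow_mul (by norm_num)]
        norm_num
      nlinarith
    have hyi : (⟪y - c, e i⟫ / r i) ^ 2 ≤ 1 :=
      (Finset.single_le_sum (f := fun j => (⟪y - c, e j⟫ / r j) ^ 2)
        (fun j _ => sq_nonneg _) (Finset.mem_univ i)).trans hy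
    have hya : |⟪y - c, e i⟫ / r i| ≤ 1 := (sq_le_one_iff_abs_le_one _).mp hyi
    simp only [nc, add_sub_cancel_left, real_inner_smul_left]
    rw [mul_div_assoc, abs_mul, abs_of_nonneg hs0]
    nlinarith [abs_nonneg (⟪y - c, e i⟫ / r i)]
  · rw [div_lt_div_iff₀ (by positivity) hr1] at hcon
    rw [div_le_div_iff₀ (by positivity) (by norm_num)]
    nlinarith
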